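/- arXiv:2307.01034 — 7 statements merged into one kernel-verified Lean document; each statement's English description precedes it below -/
import Mathlib

section
/- Let M : Y ⇉ X be a set-valued mapping, where Y is a real normed space and X is a reflexive real Banach space (i.e. the canonical embedding of X into its bidual is surjective). Assume that gph M is a nonempty convex set and that M(y) is closed for every y. Then Hof M = sup_{y ∈ dom M} Lipusc M(y) = sup_{(y,x) ∈ gph M} clm M(y,x). -/
open scoped ENNReal
open Filter EMetric Set

/-- Calmness modulus of a set-valued mapping `M` at `(ybar, xbar)`:
`limsup_{x → xbar} d(x, M(ybar)) / d(ybar, M⁻¹(x))`, with conventions `0/0 = 0`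
and `d(·, ∅) = ∞` (automatic in `ℝ≥0∞`). -/
noncomputable def clmMod {Y X : Type*} [PseudoEMetricSpace Y] [PseudoEMetricSpace X]
    (M : Y → Set X) (ybar : Y) (xbar : X) : ℝ≥0∞ :=
  Filter.limsup
    (fun x => EMetric.infEdist x (M ybar) / EMetric.infEdist ybar {y | x ∈ M y}) (nhds xbar)

/-- Lipschitz upper semicontinuity modulus of `M` at `ybar`:
`limsup_{y → ybar} sup_{x ∈ M(y)} d(x, M(ybar)) / d(y, ybar)`. -/
noncomputable def lipuscMod {Y X : Type*} [PseudoEMetricSpace Y] [PseudoEMetricSpace X]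
    (M : Y → Set X) (ybar : Y) : ℝ≥0∞ :=
  Filter.limsup
    (fun y => ⨆ x ∈ M y, EMetric.infEdist x (M ybar) / edist y ybar) (nhds ybar)

/-- Hoffman constant of `M`:
`sup_{(y,x) ∈ dom M × X} d(x, M(y)) / d(y, M⁻¹(x))`. -/
noncomputable def hofConst {Y X : Type*} [PseudoEMetricSpace Y] [PseudoEMetricSpace X]
    (M : Y → Set X) : ℝ≥0∞ :=
  ⨆ y ∈ {y | (M y).Nonempty}, ⨆ x : X,
    EMetric.infEdist x (M y) / EMetric.infEdist y {y' | x ∈ M y'}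

theorem div_infEDist_le {Y : Type*} [PseudoEMetricSpace Y] {a c : ℝ≥0∞} {y : Y} {s : Set Y}
    (h : ∀ y' ∈ s, a / edist y y' ≤ c) : a / Metric.infEDist y s ≤ c := by
  simp only [Metric.infEDist, div_eq_mul_inv, ENNReal.inv_iInf, ENNReal.mul_iSup] at h ⊢
  exact iSup₂_le h

/-- In a reflexive space, nonempty closed convex sets are proximinal. -/
theorem exists_infEDist_eq_edist_of_reflexive {X : Type*} [NormedAddCommGroup X]
    [NormedSpace ℝ X] (hrefl : Function.Surjective (NormedSpace.inclusionInDoubleDual ℝ X))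
    {C : Set X} (hne : C.Nonempty) (hconv : Convex ℝ C) (hcl : IsClosed C) (x : X) :
    ∃ z ∈ C, Metric.infEDist x C = edist x z := by
  have hex : ∀ n : ℕ, ∃ u ∈ C, dist x u < Metric.infDist x C + 1 / ((n : ℝ) + 1) := fun n =>
    (Metric.infDist_lt_iff hne).1 (lt_add_of_pos_right _ (by positivity))
  choose u huC hu using hex
  let φ : ℕ → WeakDual ℝ (StrongDual ℝ X) := fun n =>
    StrongDual.toWeakDual (NormedSpace.inclusionInDoubleDual ℝ X (u n))
  let R := ‖x‖ + (Metric.infDist x C + 1)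
  have hφ : ∀ n, φ n ∈ (WeakDual.toStrongDual ⁻¹' Metric.closedBall 0 R :
      Set (WeakDual ℝ (StrongDual ℝ X))) := by
    intro n
    have h1 : ‖NormedSpace.inclusionInDoubleDual ℝ X (u n)‖ ≤ ‖u n‖ :=
      NormedSpace.double_dual_bound ℝ X (u n)
    have h2 : ‖u n‖ ≤ ‖x‖ + dist x (u n) := by
      rw [dist_comm, dist_eq_norm]
      exact norm_le_insert' _ _
    have h3 : 1 / ((n : ℝ) + 1) ≤ 1 := by
      rw [div_le_one (by positivity)]
      linarith [(Nat.cast_nonneg n : (0 : ℝ) ≤ n)]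
    have h4 := hu n
    exact (mem_closedBall_zero_iff (E := StrongDual ℝ (StrongDual ℝ X))).2
      (h1.trans (h2.trans (by linarith)))
  obtain ⟨ψ, -, hψ⟩ := (WeakDual.isCompact_closedBall (𝕜 := ℝ)
    (0 : StrongDual ℝ (StrongDual ℝ X)) R).ultrafilter_le_nhds ((hyperfilter ℕ).map φ)
    (by
      rw [le_principal_iff]
      exact Filter.mem_map.2 (Filter.univ_mem' hφ))
  obtain ⟨z, hz⟩ := hrefl (WeakDual.toStrongDual ψ)
  have hlim : ∀ f : StrongDual ℝ X,
      Tendsto (fun n => f (u n)) (hyperfilter ℕ : Filter ℕ) (nhds (f z)) := by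
    intro f
    have h1 : Tendsto (fun n => φ n f) (hyperfilter ℕ : Filter ℕ) (nhds (ψ f)) :=
      ((WeakDual.eval_continuous f).tendsto ψ).comp hψ
    have h2 : ψ f = f z := by
      rw [← WeakDual.toStrongDual_apply, ← hz, NormedSpace.dual_def]
    rwa [h2] at h1
  have hzC : z ∈ C := by
    by_contra hzC
    obtain ⟨f, c, hf, hfz⟩ := geometric_hahn_banach_closed_point hconv hcl hzC
    exact hfz.not_ge (le_of_tendsto' (hlim f) fun n => (hf _ (huC n)).le)
  refine ⟨z, hzC, le_antisymm (Metric.infEDist_le_edist_of_mem hzC) ?_⟩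
  obtain ⟨f, hf1, hf⟩ := exists_dual_vector'' ℝ (z - x)
  have hle : dist x z ≤ Metric.infDist x C := by
    have h0 : dist x z = f z - f x := by
      rw [← map_sub, hf, dist_comm, dist_eq_norm]
      rfl
    rw [h0]
    have hseq : Tendsto (fun n : ℕ => Metric.infDist x C + 1 / ((n : ℝ) + 1))
        (hyperfilter ℕ : Filter ℕ) (nhds (Metric.infDist x C + 0)) :=
      (tendsto_const_nhds.add tendsto_one_div_add_atTop_nhds_zero_nat).mono_left
        Nat.hyperfilter_le_atTop
    rw [add_zero] at hseq
    refine le_of_tendsto_of_tendsto' ((hlim f).sub_const (f x)) hseq fun n => ?_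
    rw [← map_sub]
    refine le_trans ?_ (hu n).le
    rw [dist_comm, dist_eq_norm]
    calc f (u n - x) ≤ ‖f (u n - x)‖ := Real.le_norm_self _
      _ ≤ 1 * ‖u n - x‖ := f.le_of_opNorm_le hf1 _
      _ = ‖u n - x‖ := one_mul _
  rw [edist_dist, ← ENNReal.ofReal_toReal (Metric.infEDist_ne_top hne)]
  exact ENNReal.ofReal_le_ofReal hle

theorem edist_left_lineMap_of_nonneg {E : Type*} [NormedAddCommGroup E] [NormedSpace ℝ E] (a b : E)
    {t : ℝ} (ht : 0 ≤ t) :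
    edist a (AffineMap.lineMap a b t) = ENNReal.ofReal t * edist a b := by
  rw [edist_dist, dist_left_lineMap, Real.norm_of_nonneg ht, ENNReal.ofReal_mul ht, edist_dist]

/-- Moving from a nearest point `z` towards `x`, the distance to the set grows linearly. -/
theorem mul_infEDist_le_infEDist_lineMap {E : Type*} [NormedAddCommGroup E] [NormedSpace ℝ E]
    {C : Set E} {x z : E} (hz : Metric.infEDist x C = edist x z) {t : ℝ} (ht0 : 0 ≤ t)
    (ht1 : t ≤ 1) :
    ENNReal.ofReal t * Metric.infEDist x C ≤ Metric.infEDist (AffineMap.lineMap z x t) C := by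
  have h1 : Metric.infEDist x C ≤ edist x (AffineMap.lineMap z x t) +
      Metric.infEDist (AffineMap.lineMap z x t) C := Metric.infEDist_le_edist_add_infEDist
  have h2 : edist x (AffineMap.lineMap z x t) = ENNReal.ofReal (1 - t) * edist x z := by
    rw [← AffineMap.lineMap_apply_one_sub, edist_left_lineMap_of_nonneg _ _ (by linarith)]
  have h3 : Metric.infEDist x C =
      ENNReal.ofReal (1 - t) * edist x z + ENNReal.ofReal t * Metric.infEDist x C := by
    rw [hz, ← add_mul, ← ENNReal.ofReal_add (by linarith) ht0]
    simp
  rw [h2] at h1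
  nth_rewrite 1 [h3] at h1
  exact (ENNReal.add_le_add_iff_left
    (ENNReal.mul_ne_top ENNReal.ofReal_ne_top (edist_ne_top _ _))).1 h1

theorem tendsto_lineMap_nhdsGT_zero {E : Type*} [NormedAddCommGroup E] [NormedSpace ℝ E]
    (a b : E) :
    Tendsto (fun t : ℝ => AffineMap.lineMap a b t) (nhdsWithin 0 (Ioi 0)) (nhds a) := by
  have h : Continuous fun t : ℝ => AffineMap.lineMap a b t := AffineMap.lineMap_continuous
  simpa using (h.tendsto 0).mono_left nhdsWithin_le_nhds

/-- Let `M : Y ⇉ X` with `Y` a real normed space and `X` a reflexive real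
Banach space (the canonical embedding into the bidual is surjective). If `gph M` is nonempty
and convex and all values `M y` are closed, then
`Hof M = sup_{y ∈ dom M} Lipusc M(y) = sup_{(y,x) ∈ gph M} clm M(y,x)`. -/
theorem hof_eq_sup_lipusc_eq_sup_clm_of_convex_graph
    {Y X : Type*} [NormedAddCommGroup Y] [NormedSpace ℝ Y]
    [NormedAddCommGroup X] [NormedSpace ℝ X] [CompleteSpace X]
    (hrefl : Function.Surjective (NormedSpace.inclusionInDoubleDual ℝ X))
    (M : Y → Set X)
    (hne : {p : Y × X | p.2 ∈ M p.1}.Nonempty)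
    (hconv : Convex ℝ {p : Y × X | p.2 ∈ M p.1})
    (hcl : ∀ y, IsClosed (M y)) :
    hofConst M = (⨆ y ∈ {y | (M y).Nonempty}, lipuscMod M y) ∧
    hofConst M = ⨆ p ∈ {p : Y × X | p.2 ∈ M p.1}, clmMod M p.1 p.2 := by
  have hseg : ∀ {y y' : Y} {z x : X} {t : ℝ}, z ∈ M y → x ∈ M y' → 0 ≤ t → t ≤ 1 →
      AffineMap.lineMap z x t ∈ M (AffineMap.lineMap y y' t) := by
    intro y y' z x t hz hx h0 h1
    have := hconv.lineMap_mem (x := (y, z)) (y := (y', x)) hz hx ⟨h0, h1⟩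
    simpa [AffineMap.lineMap_apply] using this
  have hMconv : ∀ y, Convex ℝ (M y) := fun y => convex_iff_segment_subset.2 fun a ha b hb => by
    rw [segment_eq_image_lineMap]
    rintro _ ⟨t, ht, rfl⟩
    simpa using hseg ha hb ht.1 ht.2
  have hsmall : ∀ᶠ t : ℝ in nhdsWithin 0 (Ioi 0), 0 < t ∧ t ≤ 1 :=
    Ioc_mem_nhdsGT zero_lt_one
  have hratio : ∀ {y y' : Y} {x z : X} {t : ℝ}, Metric.infEDist x (M y) = edist x z →
      0 < t → t ≤ 1 → Metric.infEDist x (M y) / edist y y' ≤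
        Metric.infEDist (AffineMap.lineMap z x t) (M y) /
          edist y (AffineMap.lineMap y y' t) := by
    intro y y' x z t hz h0 h1
    rw [edist_left_lineMap_of_nonneg _ _ h0.le,
      ← ENNReal.mul_div_mul_left _ _ (ENNReal.ofReal_pos.2 h0).ne' ENNReal.ofReal_ne_top]
    exact ENNReal.div_le_div_right (mul_infEDist_le_infEDist_lineMap hz h0.le h1) _
  refine ⟨le_antisymm ?_ ?_, le_antisymm ?_ ?_⟩
  · refine iSup₂_le fun y hy => iSup_le fun x => div_infEDist_le fun y' hx => ?_
    obtain ⟨z, hzM, hz⟩ := exists_infEDist_eq_edist_of_reflexive hrefl hy (hMconv y) (hcl y) x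
    refine le_iSup₂_of_le y hy (le_limsup_of_frequently_le ?_)
    refine (tendsto_lineMap_nhdsGT_zero y y').frequently (Eventually.frequently ?_)
    filter_upwards [hsmall] with t ht
    refine le_iSup₂_of_le _ (hseg hzM hx ht.1.le ht.2) ?_
    rw [edist_comm (AffineMap.lineMap y y' t) y]
    exact hratio hz ht.1 ht.2
  · refine iSup₂_le fun y hy => limsup_le_iSup.trans (iSup_le fun y' => iSup₂_le fun x hx => ?_)
    refine le_iSup₂_of_le y hy (le_iSup_of_le x (ENNReal.div_le_div_left ?_ _))
    rw [edist_comm]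
    exact Metric.infEDist_le_edist_of_mem (s := {y' | x ∈ M y'}) hx
  · refine iSup₂_le fun y hy => iSup_le fun x => div_infEDist_le fun y' hx => ?_
    obtain ⟨z, hzM, hz⟩ := exists_infEDist_eq_edist_of_reflexive hrefl hy (hMconv y) (hcl y) x
    refine le_iSup₂_of_le (y, z) hzM (le_limsup_of_frequently_le ?_)
    refine (tendsto_lineMap_nhdsGT_zero z x).frequently (Eventually.frequently ?_)
    filter_upwards [hsmall] with t ht
    have hle : Metric.infEDist y {v | AffineMap.lineMap z x t ∈ M v} ≤
        edist y (AffineMap.lineMap y y' t) :=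
      Metric.infEDist_le_edist_of_mem (hseg hzM hx ht.1.le ht.2)
    exact (hratio hz ht.1 ht.2).trans (ENNReal.div_le_div_left hle _)
  · refine iSup₂_le fun p hp => limsup_le_iSup.trans (iSup_le fun x => ?_)
    exact le_iSup₂_of_le p.1 ⟨p.2, hp⟩ (le_iSup_of_le x le_rfl)
end

section
/- Let (c̄,b̄) ∈ dom F^op. Then there exists ε > 0 such that for every b ∈ dom F with ‖b − b̄‖∞ ≤ ε one has M_{c̄,b} ⊆ M_{c̄,b̄}. -/
open scoped ENNReal RealInnerProductSpace
open Filter EMetric Set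

/-- The feasible set mapping `F(b) = {x ∈ ℝⁿ : ⟨a_t, x⟩ ≤ b_t for all t ∈ T}`. -/
def Feas {n m : ℕ} (a : Fin m → EuclideanSpace ℝ (Fin n)) (b : Fin m → ℝ) :
    Set (EuclideanSpace ℝ (Fin n)) :=
  {x | ∀ t, ⟪a t, x⟫ ≤ b t}

/-- The optimal set (argmin) mapping `F^op(c,b) = argmin{⟨c,x⟩ : x ∈ F(b)}`. -/
def Fop {n m : ℕ} (a : Fin m → EuclideanSpace ℝ (Fin n)) (c : EuclideanSpace ℝ (Fin n))
    (b : Fin m → ℝ) : Set (EuclideanSpace ℝ (Fin n)) :=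
  {x | x ∈ Feas a b ∧ ∀ y ∈ Feas a b, ⟪c, x⟫ ≤ ⟪c, y⟫}

/-- Active index set `T_b(x) = {t ∈ T : ⟨a_t, x⟩ = b_t}`. -/
def activeSet {n m : ℕ} (a : Fin m → EuclideanSpace ℝ (Fin n)) (b : Fin m → ℝ)
    (x : EuclideanSpace ℝ (Fin n)) : Set (Fin m) :=
  {t | ⟪a t, x⟫ = b t}

/-- `z ∈ cone{a_t : t ∈ D}` (conical convex hull). -/
def InCone {n m : ℕ} (a : Fin m → EuclideanSpace ℝ (Fin n)) (D : Finset (Fin m))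
    (z : EuclideanSpace ℝ (Fin n)) : Prop :=
  ∃ lam : Fin m → ℝ, (∀ t, 0 ≤ lam t) ∧ (∀ t ∉ D, lam t = 0) ∧ z = ∑ t, lam t • a t

/-- The family of minimal KKT index subsets `M_{c,b}`: all `D ⊆ T_b(x)` (for an optimal
point `x ∈ F^op(c,b)`; independent of the choice of `x`) with `−c ∈ cone{a_t : t ∈ D}`,
minimal with respect to inclusion among such subsets. (It is empty when `F^op(c,b) = ∅`.) -/
def Mcb {n m : ℕ} (a : Fin m → EuclideanSpace ℝ (Fin n)) (c : EuclideanSpace ℝ (Fin n))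
    (b : Fin m → ℝ) : Set (Finset (Fin m)) :=
  {D | ∃ x ∈ Fop a c b, (D : Set (Fin m)) ⊆ activeSet a b x ∧ InCone a D (-c) ∧
    ∀ D' ⊆ D, InCone a D' (-c) → D' = D}

/-- The image of a polyhedral cone under a linear map is closed. -/
theorem isClosed_image_polyhedralCone {E W ι : Type*} [Fintype ι]
    [NormedAddCommGroup E] [NormedSpace ℝ E] [FiniteDimensional ℝ E]
    [NormedAddCommGroup W] [NormedSpace ℝ W] (f : E →ₗ[ℝ] W) (l : ι → E →ₗ[ℝ] ℝ)
    (V : Submodule ℝ E) : IsClosed (f '' {x | x ∈ V ∧ ∀ i, 0 ≤ l i x}) := by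
  induction V using WellFoundedLT.induction with
  | ind V ih =>
    have cut : ∀ (k : E), k ∈ V → ∀ φ : E →ₗ[ℝ] ℝ, φ k ≠ 0 →
        IsClosed (f '' {x | x ∈ V ⊓ LinearMap.ker φ ∧ ∀ i, 0 ≤ l i x}) := fun k hk φ hφ =>
      ih _ (lt_of_le_of_ne inf_le_left fun h => hφ (by rw [← h] at hk; exact hk.2))
    by_cases hinj : ∀ k ∈ V, f k = 0 → k = 0
    · have hker : LinearMap.ker (f.domRestrict V) = ⊥ := by
        rw [LinearMap.ker_eq_bot']
        exact fun k hk => Subtype.ext (hinj k k.2 hk)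
      have himage : f '' {x | x ∈ V ∧ ∀ i, 0 ≤ l i x} =
          f.domRestrict V '' {x : V | ∀ i, 0 ≤ l i x} := by
        ext w
        constructor
        · rintro ⟨x, ⟨hx, hl⟩, rfl⟩
          exact ⟨⟨x, hx⟩, hl, rfl⟩
        · rintro ⟨x, hl, rfl⟩
          exact ⟨x, ⟨x.2, hl⟩, rfl⟩
      rw [himage]
      refine (LinearMap.isClosedEmbedding_of_injective hker).isClosedMap _ ?_
      simp only [ofPred_forall]
      exact isClosed_iInter fun i => isClosed_le continuous_const
        ((l i).continuous_of_finiteDimensional.comp continuous_subtype_val)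
    · push Not at hinj
      obtain ⟨k, hkV, hfk, hk0⟩ := hinj
      by_cases hl : ∀ i, l i k = 0
      · obtain ⟨φ, hφ⟩ : ∃ φ : Module.Dual ℝ E, φ k ≠ 0 := by
          by_contra! h
          exact hk0 ((Module.forall_dual_apply_eq_zero_iff ℝ k).1 h)
        convert cut k hkV φ hφ using 1
        apply Subset.antisymm
        · rintro _ ⟨x, ⟨hx, hlx⟩, rfl⟩
          refine ⟨x - (φ x / φ k) • k, ⟨⟨V.sub_mem hx (V.smul_mem _ hkV), ?_⟩, ?_⟩, ?_⟩
          · simp [hφ]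
          · simpa [hl] using hlx
          · simp [hfk]
        · exact image_mono fun x hx => ⟨hx.1.1, hx.2⟩
      · obtain ⟨k, hkV, hfk, hneg⟩ : ∃ k ∈ V, f k = 0 ∧ ∃ i, l i k < 0 := by
          push Not at hl
          obtain ⟨i, hi⟩ := hl
          rcases lt_or_gt_of_ne hi with hi | hi
          · exact ⟨k, hkV, hfk, i, hi⟩
          · exact ⟨-k, V.neg_mem hkV, by simp [hfk], i, by simpa using hi⟩
        have hunion : f '' {x | x ∈ V ∧ ∀ i, 0 ≤ l i x} =
            ⋃ i : {i // l i k < 0},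
              f '' {x | x ∈ V ⊓ LinearMap.ker (l i) ∧ ∀ j, 0 ≤ l j x} := by
          apply Subset.antisymm
          · rintro _ ⟨x, ⟨hx, hlx⟩, rfl⟩
            obtain ⟨i₀, hi₀⟩ := hneg
            have : Nonempty {i // l i k < 0} := ⟨⟨i₀, hi₀⟩⟩
            obtain ⟨⟨i, hi⟩, hmin⟩ :=
              Finite.exists_min fun i : {i // l i k < 0} => l i x / -l i k
            simp only [Subtype.forall] at hmin
            refine mem_iUnion.2 ⟨⟨i, hi⟩, x + (l i x / -l i k) • k,
              ⟨⟨V.add_mem hx (V.smul_mem _ hkV), ?_⟩, fun j => ?_⟩, by simp [hfk]⟩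
            · have := hi.ne
              change l i (x + (l i x / -l i k) • k) = 0
              simp only [map_add, map_smul, smul_eq_mul]
              field_simp
              ring
            · simp only [map_add, map_smul, smul_eq_mul]
              rcases lt_or_ge (l j k) 0 with hj | hj
              · have := hmin j hj
                rw [le_div_iff₀ (by linarith)] at this
                linarith
              · have : 0 ≤ l i x / -l i k := div_nonneg (hlx i) (by linarith)
                have := mul_nonneg this hj
                linarith [hlx j]
          · exact iUnion_subset fun i => image_mono fun x hx => ⟨hx.1.1, hx.2⟩
        rw [hunion]
        exact isClosed_iUnion_of_finite fun i => cut k hkV (l i) i.2.ne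

/-- The right-hand sides for which some feasible point is active on `D` form a closed set. -/
theorem isClosed_setOf_exists_feas_active {n m : ℕ} (a : Fin m → EuclideanSpace ℝ (Fin n))
    (D : Finset (Fin m)) :
    IsClosed {b : Fin m → ℝ | ∃ x ∈ Feas a b, (D : Set (Fin m)) ⊆ activeSet a b x} := by
  let slack : Fin m → (EuclideanSpace ℝ (Fin n) × (Fin m → ℝ)) →ₗ[ℝ] ℝ := fun t =>
    LinearMap.proj t ∘ₗ LinearMap.snd ℝ _ _
  let f : (EuclideanSpace ℝ (Fin n) × (Fin m → ℝ)) →ₗ[ℝ] (Fin m → ℝ) :=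
    LinearMap.pi fun t => (innerₛₗ ℝ (a t)) ∘ₗ LinearMap.fst ℝ _ _ + slack t
  suffices himage : {b : Fin m → ℝ | ∃ x ∈ Feas a b, (D : Set (Fin m)) ⊆ activeSet a b x} =
      f '' {p | p ∈ (⨅ t ∈ D, LinearMap.ker (slack t)) ∧ ∀ t, 0 ≤ slack t p} by
    rw [himage]
    exact isClosed_image_polyhedralCone f slack _
  ext b
  constructor
  · rintro ⟨x, hx, hD⟩
    refine ⟨(x, fun t => b t - ⟪a t, x⟫), ⟨?_, fun t => sub_nonneg.2 (hx t)⟩, ?_⟩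
    · simp only [Submodule.mem_iInf]
      exact fun t ht => sub_eq_zero.2 (hD ht).symm
    · ext t
      exact add_sub_cancel _ _
  · rintro ⟨⟨x, s⟩, ⟨hD, hs⟩, rfl⟩
    simp only [Submodule.mem_iInf] at hD
    refine ⟨x, fun t => le_add_of_nonneg_right (hs t), fun t ht => ?_⟩
    have hst : s t = 0 := hD t ht
    change ⟪a t, x⟫ = ⟪a t, x⟫ + s t
    rw [hst, add_zero]

/-- The KKT conditions are sufficient for optimality. -/
theorem mem_Fop_of_inCone {n m : ℕ} {a : Fin m → EuclideanSpace ℝ (Fin n)}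
    {c x : EuclideanSpace ℝ (Fin n)} {b : Fin m → ℝ} {D : Finset (Fin m)}
    (hx : x ∈ Feas a b) (hD : (D : Set (Fin m)) ⊆ activeSet a b x) (hc : InCone a D (-c)) :
    x ∈ Fop a c b := by
  refine ⟨hx, fun y hy => ?_⟩
  obtain ⟨lam, hnonneg, hzero, hsum⟩ := hc
  have hinner (z : EuclideanSpace ℝ (Fin n)) : -⟪c, z⟫ = ∑ t, lam t * ⟪a t, z⟫ := by
    rw [← inner_neg_left, hsum, sum_inner]
    simp only [real_inner_smul_left]
  rw [← neg_le_neg_iff, hinner, hinner]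
  refine Finset.sum_le_sum fun t _ => ?_
  by_cases ht : t ∈ D
  · have hact : ⟪a t, x⟫ = b t := hD ht
    rw [hact]
    exact mul_le_mul_of_nonneg_left (hy t) (hnonneg t)
  · simp [hzero t ht]

/-- Let `(c̄,b̄) ∈ dom F^op`. Then there exists `ε > 0` such that for every
`b ∈ dom F` with `‖b − b̄‖∞ ≤ ε` one has `M_{c̄,b} ⊆ M_{c̄,b̄}`. -/
theorem exists_eps_Mcb_subset {n m : ℕ} (a : Fin m → EuclideanSpace ℝ (Fin n))
    (cbar : EuclideanSpace ℝ (Fin n)) (bbar : Fin m → ℝ)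
    (h : (Fop a cbar bbar).Nonempty) :
    ∃ ε > (0 : ℝ), ∀ b : Fin m → ℝ, (Feas a b).Nonempty → ‖b - bbar‖ ≤ ε →
      Mcb a cbar b ⊆ Mcb a cbar bbar := by
  have hev : ∀ᶠ b in nhds bbar, ∀ D : Finset (Fin m),
      (∃ x ∈ Feas a b, (D : Set (Fin m)) ⊆ activeSet a b x) →
        ∃ x ∈ Feas a bbar, (D : Set (Fin m)) ⊆ activeSet a bbar x := by
    refine eventually_all.2 fun D => ?_
    by_cases hD : ∃ x ∈ Feas a bbar, (D : Set (Fin m)) ⊆ activeSet a bbar x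
    · exact Eventually.of_forall fun _ _ => hD
    · filter_upwards [(isClosed_setOf_exists_feas_active a D).isOpen_compl.mem_nhds hD]
        with b hb hb' using absurd hb' hb
  obtain ⟨ε, hε, hball⟩ := Metric.nhds_basis_closedBall.eventually_iff.1 hev
  refine ⟨ε, hε, fun b _ hb D hD => ?_⟩
  obtain ⟨x, hx, hact, hcone, hmin⟩ := hD
  obtain ⟨y, hy, hyact⟩ := hball (mem_closedBall_iff_norm.2 hb) D ⟨x, hx.1, hact⟩
  exact ⟨y, mem_Fop_of_inCone hy hyact hcone, hyact, hcone, hmin⟩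
end

section
/- Let (c̄,b̄) ∈ dom F^op. Then for every D ∈ M_{c̄,b̄} one has L_D(b̄, −b̄_D) = F^op(c̄,b̄), where b̄_D = (b̄_t)_{t∈D}; that is, {x ∈ ℝ^n : a_t'x ≤ b̄_t for all t ∈ T, and a_t'x = b̄_t for all t ∈ D} = F^op(c̄,b̄). -/
open scoped ENNReal RealInnerProductSpace
open Filter EMetric Set

/-- `L_D(b,d) = {x : ⟨a_t,x⟩ ≤ b_t, t ∈ T; −⟨a_t,x⟩ ≤ d_t, t ∈ D}`. -/
def LD {n m : ℕ} (a : Fin m → EuclideanSpace ℝ (Fin n)) (D : Finset (Fin m))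
    (b d : Fin m → ℝ) : Set (EuclideanSpace ℝ (Fin n)) :=
  {x | (∀ t, ⟪a t, x⟫ ≤ b t) ∧ ∀ t ∈ D, -⟪a t, x⟫ ≤ d t}

/-- The objective in terms of a conical representation of `-c`. -/
theorem inner_eq_neg_sum_of_neg_eq {n m : ℕ} {a : Fin m → EuclideanSpace ℝ (Fin n)}
    {c : EuclideanSpace ℝ (Fin n)} {lam : Fin m → ℝ} (h : -c = ∑ t, lam t • a t)
    (x : EuclideanSpace ℝ (Fin n)) : ⟪c, x⟫ = -∑ t, lam t * ⟪a t, x⟫ := by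
  rw [← neg_neg c, h, inner_neg_left, sum_inner]
  simp only [real_inner_smul_left]

/-- The multipliers of a minimal conical representation are positive. -/
theorem pos_of_minimal_cone {n m : ℕ} {a : Fin m → EuclideanSpace ℝ (Fin n)}
    {z : EuclideanSpace ℝ (Fin n)} {D : Finset (Fin m)} {lam : Fin m → ℝ}
    (hnonneg : ∀ t, 0 ≤ lam t) (hzero : ∀ t ∉ D, lam t = 0) (hz : z = ∑ t, lam t • a t)
    (hmin : ∀ D' ⊆ D, InCone a D' z → D' = D) {t : Fin m} (ht : t ∈ D) : 0 < lam t := by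
  refine (hnonneg t).lt_of_ne' fun h0 => ?_
  have hcone : InCone a (D.erase t) z := by
    refine ⟨lam, hnonneg, fun s hs => ?_, hz⟩
    by_cases hst : s = t
    · rwa [hst]
    · exact hzero s fun hsD => hs (Finset.mem_erase.2 ⟨hst, hsD⟩)
  exact Finset.erase_eq_self.1 (hmin _ (Finset.erase_subset t D) hcone) ht

/-- The equality form of `LD` describes the optimal set. -/
theorem eq_on_minimal_eq_Fop {n m : ℕ} {a : Fin m → EuclideanSpace ℝ (Fin n)}
    {c : EuclideanSpace ℝ (Fin n)} {b : Fin m → ℝ} {D : Finset (Fin m)} (hD : D ∈ Mcb a c b) :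
    {x : EuclideanSpace ℝ (Fin n) | (∀ t, ⟪a t, x⟫ ≤ b t) ∧ ∀ t ∈ D, ⟪a t, x⟫ = b t}
      = Fop a c b := by
  obtain ⟨x₀, hx₀, hact, ⟨lam, hnonneg, hzero, hc⟩, hmin⟩ := hD
  have hval : ∀ x, (∀ t ∈ D, ⟪a t, x⟫ = b t) → ⟪c, x⟫ = -∑ t, lam t * b t := by
    intro x hx
    rw [inner_eq_neg_sum_of_neg_eq hc]
    refine congrArg Neg.neg (Finset.sum_congr rfl fun t _ => ?_)
    by_cases ht : t ∈ D
    · rw [hx t ht]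
    · simp [hzero t ht]
  have hx₀val := hval x₀ fun t ht => hact ht
  ext x
  constructor
  · rintro ⟨hfeas, heq⟩
    exact ⟨hfeas, fun y hy => (hval x heq).trans hx₀val.symm ▸ hx₀.2 y hy⟩
  · rintro ⟨hfeas, hopt⟩
    refine ⟨hfeas, fun t ht => ?_⟩
    have hle : ∀ s ∈ Finset.univ, lam s * ⟪a s, x⟫ ≤ lam s * b s := fun s _ =>
      mul_le_mul_of_nonneg_left (hfeas s) (hnonneg s)
    have hsum : ∑ s, lam s * ⟪a s, x⟫ = ∑ s, lam s * b s := by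
      have h := (hopt x₀ hx₀.1).antisymm (hx₀.2 x hfeas)
      rw [hx₀val, inner_eq_neg_sum_of_neg_eq hc] at h
      exact neg_injective h
    exact mul_left_cancel₀ (pos_of_minimal_cone hnonneg hzero hc hmin ht).ne'
      ((Finset.sum_eq_sum_iff_of_le hle).1 hsum t (Finset.mem_univ t))

/-- Let `(c̄,b̄) ∈ dom F^op`. Then for every `D ∈ M_{c̄,b̄}` one has
`L_D(b̄, −b̄_D) = F^op(c̄,b̄)`, i.e.
`{x : ⟨a_t,x⟩ ≤ b̄_t ∀ t ∈ T, ⟨a_t,x⟩ = b̄_t ∀ t ∈ D} = F^op(c̄,b̄)`. -/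
theorem LD_eq_Fop {n m : ℕ} (a : Fin m → EuclideanSpace ℝ (Fin n))
    (cbar : EuclideanSpace ℝ (Fin n)) (bbar : Fin m → ℝ)
    (h : (Fop a cbar bbar).Nonempty) :
    ∀ D ∈ Mcb a cbar bbar,
      LD a D bbar (fun t => -(bbar t)) = Fop a cbar bbar ∧
      {x : EuclideanSpace ℝ (Fin n) | (∀ t, ⟪a t, x⟫ ≤ bbar t) ∧ ∀ t ∈ D, ⟪a t, x⟫ = bbar t}
        = Fop a cbar bbar := by
  intro D hD
  refine ⟨?_, eq_on_minimal_eq_Fop hD⟩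
  rw [← eq_on_minimal_eq_Fop hD]
  ext x
  refine and_congr_right fun hfeas => forall₂_congr fun t _ => ?_
  exact neg_le_neg_iff.trans ⟨fun hle => (hfeas t).antisymm hle, fun heq => heq.ge⟩
end

section
/- Let (c̄,b̄) ∈ dom F^op. Then Lipusc F^op(c̄,b̄) = Lipusc F_c̄^op(b̄) = sup_{x ∈ F^op(c̄,b̄)} clm F^op((c̄,b̄),x) = max_{x ∈ E^op(c̄,b̄)} clm F^op((c̄,b̄),x); in particular the supremum over all x ∈ F^op(c̄,b̄) is attained at some point of the finite set E^op(c̄,b̄). -/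
open scoped ENNReal RealInnerProductSpace
open Filter EMetric Set

/-- `E^op(c,b) = extr(F^op(c,b) ∩ span{a_t : t ∈ T})`. -/
def Eop {n m : ℕ} (a : Fin m → EuclideanSpace ℝ (Fin n)) (c : EuclideanSpace ℝ (Fin n))
    (b : Fin m → ℝ) : Set (EuclideanSpace ℝ (Fin n)) :=
  Set.extremePoints ℝ
    (Fop a c b ∩ (Submodule.span ℝ (Set.range a) : Set (EuclideanSpace ℝ (Fin n))))

/-- Karush–Kuhn–Tucker multipliers: `lam` certifies that a feasible `x` is optimal for `(c, b)`. -/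
def IsKKT {n m : ℕ} (a : Fin m → EuclideanSpace ℝ (Fin n)) (c : EuclideanSpace ℝ (Fin n))
    (b : Fin m → ℝ) (x : EuclideanSpace ℝ (Fin n)) (lam : Fin m → ℝ) : Prop :=
  (∀ t, 0 ≤ lam t) ∧ -c = ∑ t, lam t • a t ∧ ∀ t, lam t ≠ 0 → ⟪a t, x⟫ = b t

section Cone

variable {n m : ℕ} {a : Fin m → EuclideanSpace ℝ (Fin n)}

theorem InCone.mono {D D' : Finset (Fin m)} (hD : D ⊆ D') {z : EuclideanSpace ℝ (Fin n)}
    (h : InCone a D z) : InCone a D' z := by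
  obtain ⟨lam, h0, h1, h2⟩ := h
  exact ⟨lam, h0, fun t ht => h1 t fun h => ht (hD h), h2⟩

/-- Carathéodory reduction: a linear dependence allows one generator to be dropped. -/
theorem InCone.exists_erase {D : Finset (Fin m)} {mu : Fin m → ℝ} (hmuD : ∀ t ∉ D, mu t = 0)
    (hmu : ∑ t, mu t • a t = 0) (hpos : ∃ t, 0 < mu t) {z : EuclideanSpace ℝ (Fin n)}
    (h : InCone a D z) : ∃ t ∈ D, InCone a (D.erase t) z := by
  obtain ⟨lam, h0, h1, h2⟩ := h
  obtain ⟨t0, ht0⟩ := hpos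
  obtain ⟨s, hs, hmin⟩ := Finset.exists_min_image (Finset.univ.filter fun t => 0 < mu t)
    (fun t => lam t / mu t) ⟨t0, by simpa using ht0⟩
  have hs' : 0 < mu s := by simpa using hs
  have hr : 0 ≤ lam s / mu s := div_nonneg (h0 s) hs'.le
  refine ⟨s, ?_, fun t => lam t - lam s / mu s * mu t, fun t => ?_, fun t ht => ?_, ?_⟩
  · by_contra hsD
    exact hs'.ne' (hmuD s hsD)
  · rcases lt_or_ge 0 (mu t) with ht | ht
    · have := hmin t (by simpa using ht)
      rw [le_div_iff₀ ht] at this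
      linarith
    · have := mul_nonneg_of_nonpos_of_nonpos (neg_nonpos.2 hr) ht
      have := h0 t
      linarith
  · by_cases hts : t = s
    · subst hts
      field_simp
      ring
    · have htD : t ∉ D := fun h => ht (Finset.mem_erase.2 ⟨hts, h⟩)
      simp [h1 t htD, hmuD t htD]
  · simp only [sub_smul, Finset.sum_sub_distrib, mul_smul, ← Finset.smul_sum, hmu, smul_zero,
      sub_zero, h2]

/-- A finitely generated convex cone is closed. -/
theorem isClosed_inCone (a : Fin m → EuclideanSpace ℝ (Fin n)) (D : Finset (Fin m)) :
    IsClosed {z | InCone a D z} := by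
  classical
  induction D using Finset.strongInduction with
  | H D ih =>
    by_cases hdep : ∃ mu : Fin m → ℝ, (∀ t ∉ D, mu t = 0) ∧ ∑ t, mu t • a t = 0 ∧ mu ≠ 0
    · obtain ⟨mu, hmuD, hmu, hne⟩ := hdep
      have key : ∃ nu : Fin m → ℝ, (∀ t ∉ D, nu t = 0) ∧ ∑ t, nu t • a t = 0 ∧ ∃ t, 0 < nu t := by
        obtain ⟨t, ht⟩ := Function.ne_iff.1 hne
        rcases lt_or_gt_of_ne ht with ht | ht
        · refine ⟨-mu, fun t ht => by simp [hmuD t ht], by simp [hmu], t, by simpa using ht⟩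
        · exact ⟨mu, hmuD, hmu, t, ht⟩
      obtain ⟨nu, hnuD, hnu, hpos⟩ := key
      have : {z | InCone a D z} = ⋃ t ∈ D, {z | InCone a (D.erase t) z} := by
        ext z
        simp only [mem_ofPred_eq, mem_iUnion, exists_prop]
        exact ⟨fun h => h.exists_erase hnuD hnu hpos,
          fun ⟨t, _, h⟩ => h.mono (Finset.erase_subset _ _)⟩
      rw [this]
      exact D.finite_toSet.isClosed_biUnion fun t ht => ih _ (Finset.erase_ssubset ht)
    · let V : Submodule ℝ (Fin m → ℝ) :=
        { carrier := {lam | ∀ t ∉ D, lam t = 0}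
          add_mem' := fun {x y} hx hy t ht => by simp [hx t ht, hy t ht]
          zero_mem' := fun t _ => rfl
          smul_mem' := fun r x hx t ht => by simp [hx t ht] }
      let f : V →ₗ[ℝ] EuclideanSpace ℝ (Fin n) := (Fintype.linearCombination ℝ a).domRestrict V
      have hf : ∀ v : V, f v = ∑ t, (v : Fin m → ℝ) t • a t := fun v => by
        simp [f, Fintype.linearCombination_apply]
      have hker : LinearMap.ker f = ⊥ := by
        rw [LinearMap.ker_eq_bot']
        intro v hv
        by_contra hne
        exact hdep ⟨v, v.2, by rw [← hf, hv], fun h => hne (Subtype.ext h)⟩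
      have hcl : IsClosed {v : V | ∀ t, 0 ≤ (v : Fin m → ℝ) t} := by
        simp only [ofPred_forall]
        exact isClosed_iInter fun t => isClosed_le continuous_const
          ((continuous_apply t).comp continuous_subtype_val)
      convert (LinearMap.isClosedEmbedding_of_injective hker).isClosedMap _ hcl using 1
      ext z
      constructor
      · rintro ⟨lam, h0, h1, h2⟩
        exact ⟨⟨lam, h1⟩, h0, by rw [hf, h2]⟩
      · rintro ⟨v, h0, rfl⟩
        exact ⟨v, h0, v.2, hf v⟩

/-- Farkas' lemma for a finitely generated cone. -/
theorem exists_inner_pos_of_not_inCone {D : Finset (Fin m)} {z : EuclideanSpace ℝ (Fin n)}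
    (hz : ¬ InCone a D z) :
    ∃ w : EuclideanSpace ℝ (Fin n), (∀ t ∈ D, ⟪a t, w⟫ ≤ 0) ∧ 0 < ⟪z, w⟫ := by
  classical
  have hconv : Convex ℝ {z | InCone a D z} := by
    rintro x ⟨l, l0, l1, rfl⟩ y ⟨k, k0, k1, rfl⟩ r s hr hs -
    refine ⟨fun t => r * l t + s * k t, fun t => ?_, fun t ht => by simp [l1 t ht, k1 t ht], ?_⟩
    · have := l0 t
      have := k0 t
      positivity
    · simp only [add_smul, mul_smul, Finset.sum_add_distrib, Finset.smul_sum]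
  obtain ⟨f, u, hfu, huz⟩ :=
    geometric_hahn_banach_closed_point hconv (isClosed_inCone a D) hz
  have hinner : ∀ x, f x = ⟪x, (InnerProductSpace.toDual ℝ _).symm f⟫ := fun x => by
    rw [real_inner_comm, InnerProductSpace.toDual_symm_apply]
  have hu : 0 < u := by
    simpa using hfu 0 ⟨0, by simp, by simp, by simp⟩
  refine ⟨(InnerProductSpace.toDual ℝ _).symm f, fun t ht => ?_, ?_⟩
  · rw [← hinner]
    by_contra! hpos
    have := hfu ((u / f (a t)) • a t) ⟨Pi.single t (u / f (a t)), fun s => ?_, fun s hs => ?_, ?_⟩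
    · simp [hpos.ne'] at this
    · by_cases h : s = t
      · subst h; simp; positivity
      · simp [h]
    · have : s ≠ t := fun h => hs (h ▸ ht)
      simp [this]
    · simp [Pi.single_apply, ite_smul]
  · rw [← hinner]
    exact hu.trans huz

end Cone

section Optimality

variable {n m : ℕ} {a : Fin m → EuclideanSpace ℝ (Fin n)} {c : EuclideanSpace ℝ (Fin n)}
  {b : Fin m → ℝ} {x : EuclideanSpace ℝ (Fin n)}

theorem inner_sum_smul_left (a : Fin m → EuclideanSpace ℝ (Fin n)) {lam : Fin m → ℝ}
    (h : -c = ∑ t, lam t • a t) (x : EuclideanSpace ℝ (Fin n)) :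
    -⟪c, x⟫ = ∑ t, lam t * ⟪a t, x⟫ := by
  rw [← inner_neg_left, h, sum_inner]
  simp [real_inner_smul_left]

theorem IsKKT.neg_inner_eq {lam : Fin m → ℝ} (h : IsKKT a c b x lam) :
    -⟪c, x⟫ = ∑ t, lam t * b t := by
  rw [inner_sum_smul_left a h.2.1]
  refine Finset.sum_congr rfl fun t _ => ?_
  by_cases ht : lam t = 0
  · simp [ht]
  · rw [h.2.2 t ht]

theorem neg_inner_le_of_mem_feas {lam : Fin m → ℝ} (h0 : ∀ t, 0 ≤ lam t)
    (hc : -c = ∑ t, lam t • a t) (hx : x ∈ Feas a b) : -⟪c, x⟫ ≤ ∑ t, lam t * b t := by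
  rw [inner_sum_smul_left a hc]
  exact Finset.sum_le_sum fun t _ => mul_le_mul_of_nonneg_left (hx t) (h0 t)

theorem IsKKT.mem_Fop {lam : Fin m → ℝ} (h : IsKKT a c b x lam) (hx : x ∈ Feas a b) :
    x ∈ Fop a c b := by
  refine ⟨hx, fun y hy => ?_⟩
  have := h.neg_inner_eq
  have := neg_inner_le_of_mem_feas h.1 h.2.1 hy
  linarith

/-- Dual feasibility together with absence of a duality gap gives complementary slackness. -/
theorem isKKT_of_sum_le {lam : Fin m → ℝ} (h0 : ∀ t, 0 ≤ lam t) (hc : -c = ∑ t, lam t • a t)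
    (hx : x ∈ Feas a b) (hle : ∑ t, lam t * b t ≤ -⟪c, x⟫) : IsKKT a c b x lam := by
  refine ⟨h0, hc, fun t ht => ?_⟩
  rw [inner_sum_smul_left a hc] at hle
  have hterm : ∀ s ∈ Finset.univ, lam s * ⟪a s, x⟫ ≤ lam s * b s := fun s _ =>
    mul_le_mul_of_nonneg_left (hx s) (h0 s)
  have := (Finset.sum_eq_sum_iff_of_le hterm).1 (le_antisymm (Finset.sum_le_sum hterm) hle) t
    (Finset.mem_univ t)
  exact mul_left_cancel₀ ht this

theorem eventually_mem_feas_add_smul (hx : x ∈ Feas a b) {w : EuclideanSpace ℝ (Fin n)}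
    (hw : ∀ t, ⟪a t, x⟫ = b t → ⟪a t, w⟫ ≤ 0) :
    ∀ᶠ r in nhdsWithin (0 : ℝ) (Ioi 0), x + r • w ∈ Feas a b := by
  refine eventually_all.2 fun t => ?_
  rcases (hx t).lt_or_eq with ht | ht
  · have hcont : Continuous fun r : ℝ => ⟪a t, x + r • w⟫ := by fun_prop
    have : ∀ᶠ r in nhds (0 : ℝ), ⟪a t, x + r • w⟫ < b t :=
      hcont.continuousAt.eventually_lt continuousAt_const (by simpa using ht)
    exact (this.filter_mono nhdsWithin_le_nhds).mono fun r hr => hr.le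
  · filter_upwards [self_mem_nhdsWithin] with r hr
    rw [inner_add_right, real_inner_smul_right, ht]
    have := mul_nonpos_of_nonneg_of_nonpos (le_of_lt hr) (hw t ht)
    linarith

/-- Necessity of the Karush–Kuhn–Tucker conditions for linear programs. -/
theorem exists_active_inCone_of_mem_Fop (hx : x ∈ Fop a c b) :
    ∃ D : Finset (Fin m), (∀ t ∈ D, ⟪a t, x⟫ = b t) ∧ InCone a D (-c) := by
  classical
  refine ⟨Finset.univ.filter fun t => ⟪a t, x⟫ = b t, by simp, ?_⟩
  by_contra hnot
  obtain ⟨w, hw, hcw⟩ := exists_inner_pos_of_not_inCone hnot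
  obtain ⟨r, hr, hr0⟩ := ((eventually_mem_feas_add_smul hx.1 (w := w)
    fun t ht => hw t (by simpa using ht)).and self_mem_nhdsWithin).exists
  have h := hx.2 _ hr
  rw [inner_add_right, real_inner_smul_right] at h
  rw [inner_neg_left] at hcw
  have hr0 : 0 < r := hr0
  nlinarith

theorem isKKT_of_inCone {D : Finset (Fin m)} {lam : Fin m → ℝ}
    (hD : ∀ t ∈ D, ⟪a t, x⟫ = b t) (h0 : ∀ t, 0 ≤ lam t) (h1 : ∀ t ∉ D, lam t = 0)
    (h2 : -c = ∑ t, lam t • a t) : IsKKT a c b x lam :=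
  ⟨h0, h2, fun t ht => hD t (by_contra fun h => ht (h1 t h))⟩

theorem exists_isKKT_of_mem_Fop (hx : x ∈ Fop a c b) : ∃ lam, IsKKT a c b x lam := by
  obtain ⟨D, hD, lam, h0, h1, h2⟩ := exists_active_inCone_of_mem_Fop hx
  exact ⟨lam, isKKT_of_inCone hD h0 h1 h2⟩

theorem isClosed_Fop (a : Fin m → EuclideanSpace ℝ (Fin n)) (c : EuclideanSpace ℝ (Fin n))
    (b : Fin m → ℝ) : IsClosed (Fop a c b) := by
  have : Fop a c b = (⋂ t, {x | ⟪a t, x⟫ ≤ b t}) ∩ ⋂ y ∈ Feas a b, {x | ⟪c, x⟫ ≤ ⟪c, y⟫} := by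
    ext x
    simp [Fop, Feas]
  rw [this]
  exact (isClosed_iInter fun t => isClosed_le (by fun_prop) continuous_const).inter
    (isClosed_biInter fun y _ => isClosed_le (by fun_prop) continuous_const)

theorem convex_Fop (a : Fin m → EuclideanSpace ℝ (Fin n)) (c : EuclideanSpace ℝ (Fin n))
    (b : Fin m → ℝ) : Convex ℝ (Fop a c b) := by
  intro x hx y hy r s hr hs hrs
  refine ⟨fun t => ?_, fun z hz => ?_⟩
  · rw [inner_add_right, real_inner_smul_right, real_inner_smul_right]
    calc r * ⟪a t, x⟫ + s * ⟪a t, y⟫ ≤ r * b t + s * b t := by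
          gcongr
          exacts [hx.1 t, hy.1 t]
      _ = b t := by rw [← add_mul, hrs, one_mul]
  · rw [inner_add_right, real_inner_smul_right, real_inner_smul_right]
    calc r * ⟪c, x⟫ + s * ⟪c, y⟫ ≤ r * ⟪c, z⟫ + s * ⟪c, z⟫ := by
          gcongr
          exacts [hx.2 z hz, hy.2 z hz]
      _ = ⟪c, z⟫ := by rw [← add_mul, hrs, one_mul]

/-- Membership in the optimal set only depends on the values of the constraint functionals. -/
theorem mem_Fop_of_inner_eq (hx : x ∈ Fop a c b) {y : EuclideanSpace ℝ (Fin n)}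
    (h : ∀ t, ⟪a t, y⟫ = ⟪a t, x⟫) : y ∈ Fop a c b := by
  obtain ⟨lam, h0, h1, h2⟩ := exists_isKKT_of_mem_Fop hx
  exact IsKKT.mem_Fop ⟨h0, h1, fun t ht => (h t).trans (h2 t ht)⟩ fun t => (h t).trans_le (hx.1 t)

/-- For parameters near `(c, b)`, every optimal point has multipliers which are also multipliers
for every optimal point of the nominal problem `(c, b)`. -/
theorem eventually_exists_isKKT (h : (Fop a c b).Nonempty) :
    ∀ᶠ p : EuclideanSpace ℝ (Fin n) × (Fin m → ℝ) in nhds (c, b), ∀ x ∈ Fop a p.1 p.2,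
      ∃ lam, IsKKT a c p.2 x lam ∧ ∀ z ∈ Fop a c b, IsKKT a c b z lam := by
  obtain ⟨x₀, hx₀⟩ := h
  obtain ⟨lam₀, hlam₀⟩ := exists_isKKT_of_mem_Fop hx₀
  have hcone : ∀ᶠ p : EuclideanSpace ℝ (Fin n) × (Fin m → ℝ) in nhds (c, b),
      ∀ D : Finset (Fin m), InCone a D (-p.1) → InCone a D (-c) := by
    refine eventually_all.2 fun D => ?_
    by_cases hD : InCone a D (-c)
    · exact Eventually.of_forall fun _ _ => hD
    · have hcont : ContinuousAt
          (fun p : EuclideanSpace ℝ (Fin n) × (Fin m → ℝ) => -p.1) (c, b) := by fun_prop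
      exact (hcont.eventually ((isClosed_inCone a D).isOpen_compl.mem_nhds hD)).mono
        fun p hp hp' => absurd hp' hp
  have hlam : ∀ D : Finset (Fin m), ∃ lam : Fin m → ℝ, InCone a D (-c) →
      (∀ t, 0 ≤ lam t) ∧ (∀ t ∉ D, lam t = 0) ∧ -c = ∑ t, lam t • a t := fun D => by
    by_cases hD : InCone a D (-c)
    · obtain ⟨lam, hlam⟩ := hD
      exact ⟨lam, fun _ => hlam⟩
    · exact ⟨0, fun h => absurd h hD⟩
  choose lam hlam using hlam
  have hdual : ∀ᶠ p : EuclideanSpace ℝ (Fin n) × (Fin m → ℝ) in nhds (c, b),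
      ∀ D : Finset (Fin m), ∑ t, lam₀ t * b t < ∑ t, lam D t * b t →
        ∑ t, lam₀ t * p.2 t < ∑ t, lam D t * p.2 t := by
    refine eventually_all.2 fun D => ?_
    by_cases hD : ∑ t, lam₀ t * b t < ∑ t, lam D t * b t
    · have h1 : ContinuousAt (fun p : EuclideanSpace ℝ (Fin n) × (Fin m → ℝ) =>
          ∑ t, lam₀ t * p.2 t) (c, b) := by fun_prop
      have h2 : ContinuousAt (fun p : EuclideanSpace ℝ (Fin n) × (Fin m → ℝ) =>
          ∑ t, lam D t * p.2 t) (c, b) := by fun_prop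
      exact (h1.eventually_lt h2 hD).mono fun p hp _ => hp
    · exact Eventually.of_forall fun _ h => absurd h hD
  filter_upwards [hcone, hdual] with p hp1 hp2 x hx
  obtain ⟨D, hact, hD⟩ := exists_active_inCone_of_mem_Fop hx
  obtain ⟨h0, h1, h2⟩ := hlam D (hp1 D hD)
  have hk : IsKKT a c p.2 x (lam D) := isKKT_of_inCone hact h0 h1 h2
  have hle : ∑ t, lam D t * b t ≤ ∑ t, lam₀ t * b t := by
    by_contra! hlt
    have := hp2 D hlt
    have := hk.neg_inner_eq
    have := neg_inner_le_of_mem_feas hlam₀.1 hlam₀.2.1 hx.1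
    linarith
  refine ⟨lam D, hk, fun z hz => isKKT_of_sum_le h0 h2 hz.1 ?_⟩
  have := hlam₀.neg_inner_eq
  have := hz.2 x₀ hx₀.1
  linarith

end Optimality

section Extreme

variable {n m : ℕ} {a : Fin m → EuclideanSpace ℝ (Fin n)} {c : EuclideanSpace ℝ (Fin n)}
  {b : Fin m → ℝ} {x : EuclideanSpace ℝ (Fin n)}

theorem inner_eq_of_mem_openSegment {u z z₁ z₂ : EuclideanSpace ℝ (Fin n)} {v : ℝ}
    (hz : z ∈ openSegment ℝ z₁ z₂) (h₁ : ⟪u, z₁⟫ ≤ v) (h₂ : ⟪u, z₂⟫ ≤ v) (h : ⟪u, z⟫ = v) :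
    ⟪u, z₁⟫ = v ∧ ⟪u, z₂⟫ = v := by
  obtain ⟨r, s, hr, hs, hrs, rfl⟩ := hz
  rw [inner_add_right, real_inner_smul_right, real_inner_smul_right] at h
  have hv : r * (v - ⟪u, z₁⟫) + s * (v - ⟪u, z₂⟫) = 0 := by linear_combination hrs * v - h
  have p₁ := mul_nonneg hr.le (sub_nonneg.2 h₁)
  have p₂ := mul_nonneg hs.le (sub_nonneg.2 h₂)
  constructor
  · have : r * (v - ⟪u, z₁⟫) = 0 := by linarith
    have := (mul_eq_zero.1 this).resolve_left hr.ne'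
    linarith
  · have : s * (v - ⟪u, z₂⟫) = 0 := by linarith
    have := (mul_eq_zero.1 this).resolve_left hs.ne'
    linarith

/-- On the span of the `a t`, a vector with bounded constraint values is bounded. -/
theorem isBounded_span_inter (a : Fin m → EuclideanSpace ℝ (Fin n)) (R : ℝ) :
    Bornology.IsBounded {x : EuclideanSpace ℝ (Fin n) |
      x ∈ Submodule.span ℝ (Set.range a) ∧ ∀ t, |⟪a t, x⟫| ≤ R} := by
  let f : Submodule.span ℝ (Set.range a) →ₗ[ℝ] (Fin m → ℝ) :=
    (LinearMap.pi fun t => (innerₛₗ ℝ (a t))).domRestrict _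
  have hf : ∀ v t, f v t = ⟪a t, (v : EuclideanSpace ℝ (Fin n))⟫ := fun v t => rfl
  have hker : LinearMap.ker f = ⊥ := by
    rw [LinearMap.ker_eq_bot']
    intro v hv
    have hperp : (v : EuclideanSpace ℝ (Fin n)) ∈ (Submodule.span ℝ (Set.range a))ᗮ := by
      rw [← Submodule.span_eq (Submodule.span ℝ (Set.range a))ᗮ]
      refine Submodule.subset_span ?_
      rw [SetLike.mem_coe, Submodule.mem_orthogonal]
      intro w hw
      induction hw using Submodule.span_induction with
      | mem w hw =>
        obtain ⟨t, rfl⟩ := hw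
        rw [← hf, hv]
        rfl
      | zero => simp
      | add y z _ _ hy hz => rw [inner_add_left, hy, hz, add_zero]
      | smul r y _ hy => rw [real_inner_smul_left, hy, mul_zero]
    have := Submodule.inner_right_of_mem_orthogonal v.2 hperp
    exact Subtype.ext (inner_self_eq_zero.1 this)
  obtain ⟨K, -, hK⟩ := f.exists_antilipschitzWith hker
  rw [isBounded_iff_forall_norm_le]
  refine ⟨K * max R 0, ?_⟩
  rintro x ⟨hx, hR⟩
  have h1 := hK.le_mul_dist ⟨x, hx⟩ 0
  have h2 : ‖f ⟨x, hx⟩‖ ≤ max R 0 := by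
    refine (pi_norm_le_iff_of_nonneg (le_max_right _ _)).2 fun t => ?_
    rw [hf]
    exact (hR t).trans (le_max_left _ _)
  rw [map_zero, dist_zero_right, dist_zero_right] at h1
  exact h1.trans (by gcongr)

/-- A nonempty closed subset of a polyhedron, lying in the span of the constraint vectors, has an
extreme point. -/
theorem extremePoints_nonempty_of_subset_feas {Q : Set (EuclideanSpace ℝ (Fin n))}
    (hQ : IsClosed Q) (hne : Q.Nonempty)
    (hspan : Q ⊆ Submodule.span ℝ (Set.range a)) (hfeas : Q ⊆ Feas a b) :
    (Q.extremePoints ℝ).Nonempty := by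
  obtain ⟨z₀, hz₀⟩ := hne
  set s := ∑ t, a t with hs
  have hsx : ∀ x, ⟪s, x⟫ = ∑ t, ⟪a t, x⟫ := fun x => sum_inner _ _ _
  have hcomp : IsCompact (Q ∩ {z | ⟪s, z₀⟫ ≤ ⟪s, z⟫}) := by
    refine Metric.isCompact_of_isClosed_isBounded
      (hQ.inter (isClosed_le continuous_const (by fun_prop))) ?_
    refine (isBounded_span_inter a (∑ t, |b t| + |⟪s, z₀⟫|)).subset ?_
    rintro z ⟨hz, hsz⟩
    refine ⟨hspan hz, fun t => ?_⟩
    have hle : ∀ t, ⟪a t, z⟫ ≤ |b t| := fun t => (hfeas hz t).trans (le_abs_self _)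
    have h1 : |b t| ≤ ∑ t, |b t| :=
      Finset.single_le_sum (f := fun t => |b t|) (fun t _ => abs_nonneg _) (Finset.mem_univ t)
    have h2 : |b t| - ⟪a t, z⟫ ≤ ∑ t, (|b t| - ⟪a t, z⟫) :=
      Finset.single_le_sum (f := fun t => |b t| - ⟪a t, z⟫) (fun t _ => sub_nonneg.2 (hle t))
        (Finset.mem_univ t)
    rw [Finset.sum_sub_distrib, ← hsx] at h2
    have h3 : ⟪s, z₀⟫ ≤ ⟪s, z⟫ := hsz
    have h4 := neg_abs_le ⟪s, z₀⟫
    have h5 := hle t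
    have h6 := abs_nonneg ⟪s, z₀⟫
    have h7 := abs_nonneg (b t)
    rw [abs_le]
    constructor <;> linarith
  obtain ⟨z₁, hz₁, hmax⟩ := hcomp.exists_isMaxOn (f := fun z => ⟪s, z⟫) ⟨z₀, hz₀, le_refl ⟪s, z₀⟫⟩
    (by fun_prop)
  have hle : ∀ z ∈ Q, ⟪s, z⟫ ≤ ⟪s, z₁⟫ := fun z hz => by
    rcases le_total ⟪s, z₀⟫ ⟪s, z⟫ with h | h
    · exact hmax ⟨hz, h⟩
    · exact h.trans hz₁.2
  have hcomp' : IsCompact (Q ∩ {z | ⟪s, z⟫ = ⟪s, z₁⟫}) := by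
    refine hcomp.of_isClosed_subset
      (hQ.inter (isClosed_eq (by fun_prop) continuous_const)) ?_
    rintro z ⟨hz, hsz⟩
    exact ⟨hz, hz₁.2.trans_eq hsz.symm⟩
  obtain ⟨e, he⟩ := hcomp'.extremePoints_nonempty ⟨z₁, hz₁.1, rfl⟩
  refine ⟨e, he.1.1, fun x₁ hx₁ x₂ hx₂ hseg => ?_⟩
  obtain ⟨h₁, h₂⟩ := inner_eq_of_mem_openSegment hseg (hle _ hx₁) (hle _ hx₂) he.1.2
  exact he.2 ⟨hx₁, h₁⟩ ⟨hx₂, h₂⟩ hseg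

theorem inner_starProjection_span (a : Fin m → EuclideanSpace ℝ (Fin n)) (t : Fin m)
    (x : EuclideanSpace ℝ (Fin n)) :
    ⟪a t, (Submodule.span ℝ (Set.range a)).starProjection x⟫ = ⟪a t, x⟫ := by
  rw [← Submodule.inner_starProjection_left_eq_right,
    Submodule.starProjection_eq_self_iff.2 (Submodule.subset_span (mem_range_self t))]

theorem Eop_nonempty (h : (Fop a c b).Nonempty) : (Eop a c b).Nonempty := by
  obtain ⟨x, hx⟩ := h
  exact extremePoints_nonempty_of_subset_feas (a := a) (b := b)
    ((isClosed_Fop a c b).inter (Submodule.closed_of_finiteDimensional _))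
    ⟨_, mem_Fop_of_inner_eq hx fun t => inner_starProjection_span a t x,
      Submodule.starProjection_apply_mem _ _⟩
    inter_subset_right fun _ hz => hz.1.1

/-- A linear functional attaining its maximum over the optimal set attains it at a point of
`Eop`. -/
theorem exists_mem_Eop_inner_eq (hx : x ∈ Fop a c b) {u : EuclideanSpace ℝ (Fin n)}
    (hu : ∀ z ∈ Fop a c b, ⟪u, z⟫ ≤ ⟪u, x⟫) : ∃ e ∈ Eop a c b, ⟪u, e⟫ = ⟪u, x⟫ := by
  set p := (Submodule.span ℝ (Set.range a)).starProjection x with hp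
  have hpt : ∀ t, ⟪a t, p⟫ = ⟪a t, x⟫ := fun t => inner_starProjection_span a t x
  have hpS : p ∈ Fop a c b := mem_Fop_of_inner_eq hx hpt
  have hpu : ⟪u, p⟫ = ⟪u, x⟫ := by
    have h1 := hu p hpS
    have h2 := hu (x + (x - p)) (mem_Fop_of_inner_eq hx fun t => by
      rw [inner_add_right, inner_sub_right, hpt]; ring)
    rw [inner_add_right, inner_sub_right] at h2
    linarith
  obtain ⟨e, he⟩ := extremePoints_nonempty_of_subset_feas (a := a) (b := b)
    (Q := (Fop a c b ∩ (Submodule.span ℝ (Set.range a) : Set (EuclideanSpace ℝ (Fin n)))) ∩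
      {z | ⟪u, z⟫ = ⟪u, x⟫})
    (((isClosed_Fop a c b).inter (Submodule.closed_of_finiteDimensional _)).inter
      (isClosed_eq (by fun_prop) continuous_const))
    ⟨p, ⟨hpS, Submodule.starProjection_apply_mem _ _⟩, hpu⟩
    (fun _ hz => hz.1.2) (fun _ hz => hz.1.1.1)
  refine ⟨e, ⟨he.1.1, fun x₁ hx₁ x₂ hx₂ hseg => ?_⟩, he.1.2⟩
  obtain ⟨h₁, h₂⟩ := inner_eq_of_mem_openSegment hseg (hu _ hx₁.1) (hu _ hx₂.1) he.1.2
  exact he.2 ⟨hx₁, h₁⟩ ⟨hx₂, h₂⟩ hseg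

theorem finite_Eop (a : Fin m → EuclideanSpace ℝ (Fin n)) (c : EuclideanSpace ℝ (Fin n))
    (b : Fin m → ℝ) : (Eop a c b).Finite := by
  refine Set.Finite.of_injOn (f := activeSet a b) (t := univ) (fun _ _ => mem_univ _) ?_
    Set.finite_univ
  intro e₁ he₁ e₂ he₂ hact
  have hiff : ∀ t, ⟪a t, e₁⟫ = b t ↔ ⟪a t, e₂⟫ = b t := fun t => Set.ext_iff.1 hact t
  obtain ⟨lam, hlam⟩ := exists_isKKT_of_mem_Fop he₁.1.1
  have hw : ∀ t, ⟪a t, e₁⟫ = b t → ⟪a t, e₁ - e₂⟫ = 0 := fun t ht => by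
    rw [inner_sub_right, ht, (hiff t).1 ht, sub_self]
  obtain ⟨r, hr, hr0⟩ := ((eventually_mem_feas_add_smul he₁.1.1.1 (w := e₁ - e₂)
    fun t ht => (hw t ht).le).and self_mem_nhdsWithin).exists
  have hr0 : 0 < r := hr0
  have hz : e₁ + r • (e₁ - e₂) ∈ Fop a c b := by
    refine IsKKT.mem_Fop ⟨hlam.1, hlam.2.1, fun t ht => ?_⟩ hr
    rw [inner_add_right, real_inner_smul_right, hw t (hlam.2.2 t ht), mul_zero, add_zero,
      hlam.2.2 t ht]
  have hzs : e₁ + r • (e₁ - e₂) ∈ Submodule.span ℝ (Set.range a) :=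
    add_mem he₁.1.2 (Submodule.smul_mem _ _ (sub_mem he₁.1.2 he₂.1.2))
  refine (he₁.2 he₂.1 ⟨hz, hzs⟩ ⟨r / (1 + r), 1 / (1 + r), by positivity, by positivity,
    by field_simp; ring, ?_⟩).symm
  match_scalars
  · field_simp
    ring
  · field_simp

end Extreme

section Moduli

/-- The calmness modulus at any point is bounded by the Lipschitz upper semicontinuity modulus. -/
theorem clmMod_le_lipuscMod {Y X : Type*} [PseudoEMetricSpace Y] [PseudoEMetricSpace X]
    {M : Y → Set X} {ybar : Y} {xbar : X} (hx : xbar ∈ M ybar) :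
    clmMod M ybar xbar ≤ lipuscMod M ybar := by
  refine le_of_forall_gt fun K hK => ?_
  obtain ⟨K', hK', hKK'⟩ := exists_between hK
  refine lt_of_le_of_lt ?_ hKK'
  have hpos : K' ≠ 0 := (bot_le.trans_lt hK').ne'
  have htop : K' ≠ ∞ := (hKK'.trans_le le_top).ne
  obtain ⟨δ, hδ, hball⟩ := EMetric.mem_nhds_iff.1 (eventually_lt_of_limsup_lt hK')
  refine limsup_le_of_le (by isBoundedDefault) ?_
  filter_upwards [Metric.eball_mem_nhds xbar (ENNReal.mul_pos hpos hδ.ne')] with x hxx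
  refine ENNReal.div_le_of_le_mul ?_
  rw [mul_comm, ← ENNReal.div_le_iff_le_mul (Or.inl hpos) (Or.inl htop)]
  refine Metric.le_infEDist.2 fun y hy => ?_
  rw [ENNReal.div_le_iff_le_mul (Or.inl hpos) (Or.inl htop), mul_comm, edist_comm]
  by_cases hyδ : edist y ybar < δ
  · have h1 : Metric.infEDist x (M ybar) / edist y ybar ≤ K' :=
      (le_iSup₂ (f := fun x (_ : x ∈ M y) => Metric.infEDist x (M ybar) / edist y ybar) x hy).trans
        (le_of_lt (hball hyδ))
    rwa [ENNReal.div_le_iff_le_mul (Or.inr htop) (Or.inr hpos)] at h1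
  · calc Metric.infEDist x (M ybar) ≤ edist x xbar := Metric.infEDist_le_edist_of_mem hx
      _ ≤ K' * δ := le_of_lt hxx
      _ ≤ K' * edist y ybar := by gcongr; exact not_lt.1 hyδ

variable {n m : ℕ} {a : Fin m → EuclideanSpace ℝ (Fin n)} {c : EuclideanSpace ℝ (Fin n)}
  {b : Fin m → ℝ}

theorem lipuscMod_Fop_fixed_cost (h : (Fop a c b).Nonempty) :
    lipuscMod (fun p : EuclideanSpace ℝ (Fin n) × (Fin m → ℝ) => Fop a p.1 p.2) (c, b)
      = lipuscMod (fun b => Fop a c b) b := by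
  apply le_antisymm
  · refine (limsup_le_limsup (v := fun p : EuclideanSpace ℝ (Fin n) × (Fin m → ℝ) =>
      ⨆ x ∈ Fop a c p.2, Metric.infEDist x (Fop a c b) / edist p.2 b) ?_ ?_ ?_).trans ?_
    · filter_upwards [eventually_exists_isKKT h] with p hp
      refine iSup₂_le fun x hx => ?_
      obtain ⟨lam, hlam, -⟩ := hp x hx
      refine le_trans (ENNReal.div_le_div_left ?_ _) (le_iSup₂ (f := fun x
        (_ : x ∈ Fop a c p.2) => Metric.infEDist x (Fop a c b) / edist p.2 b) x
          (hlam.mem_Fop hx.1))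
      rw [Prod.edist_eq]
      exact le_max_right _ _
    · isBoundedDefault
    · isBoundedDefault
    · exact limsup_le_limsup_of_le (f := map Prod.snd (nhds (c, b)))
        (u := fun b' => ⨆ x ∈ Fop a c b', Metric.infEDist x (Fop a c b) / edist b' b)
        (continuousAt_snd (p := (c, b)))
  · have htend : Tendsto (fun b' : Fin m → ℝ => (c, b')) (nhds b) (nhds (c, b)) :=
      (Continuous.prodMk_right c).continuousAt
    refine le_trans (le_of_eq ?_) (limsup_le_limsup_of_le htend)
    rw [lipuscMod, limsup, limsup, map_map]
    congr 2
    funext b'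
    simp [Prod.edist_eq]

theorem infEDist_eq_of_inner_nonpos {S : Set (EuclideanSpace ℝ (Fin n))}
    {x p : EuclideanSpace ℝ (Fin n)} (hp : p ∈ S) (h : ∀ z ∈ S, ⟪x - p, z - p⟫ ≤ 0) :
    Metric.infEDist x S = edist x p := by
  refine le_antisymm (Metric.infEDist_le_edist_of_mem hp) (Metric.le_infEDist.2 fun z hz => ?_)
  rw [edist_dist, edist_dist, dist_eq_norm, dist_eq_norm]
  refine ENNReal.ofReal_le_ofReal (pow_le_pow_iff_left₀ (norm_nonneg _) (norm_nonneg _) two_ne_zero |>.1 ?_)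
  have hsq := norm_sub_sq_real (x - p) (z - p)
  rw [sub_sub_sub_cancel_right] at hsq
  nlinarith [h z hz, sq_nonneg ‖z - p‖]

/-- Local scaling towards an extreme point: a point optimal for a nearby right-hand side can be
contracted to some `e ∈ Eop` with distances scaling exactly. -/
theorem exists_mem_Eop_contraction {b' : Fin m → ℝ} {x : EuclideanSpace ℝ (Fin n)}
    {lam : Fin m → ℝ} (hS : (Fop a c b).Nonempty) (hx : x ∈ Feas a b')
    (hk : IsKKT a c b' x lam) (hkS : ∀ z ∈ Fop a c b, IsKKT a c b z lam) :
    ∃ e ∈ Eop a c b, ∀ r : ℝ, 0 < r → r ≤ 1 →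
      e + r • (x - e) ∈ Fop a c (b + r • (b' - b)) ∧
      Metric.infEDist (e + r • (x - e)) (Fop a c b)
        = ENNReal.ofReal r * Metric.infEDist x (Fop a c b) := by
  obtain ⟨p, hp, hmin⟩ := exists_norm_eq_iInf_of_complete_convex hS
    (isClosed_Fop a c b).isComplete (convex_Fop a c b) x
  have hproj := (norm_eq_iInf_iff_real_inner_le_zero (convex_Fop a c b) hp).1 hmin
  obtain ⟨e, he, heu⟩ := exists_mem_Eop_inner_eq hp (u := x - p) fun z hz => by
    have := hproj z hz
    rw [inner_sub_right] at this
    linarith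
  have heS := he.1.1
  have hke := hkS e heS
  refine ⟨e, he, fun r hr hr1 => ⟨?_, ?_⟩⟩
  · have hval : ∀ t, ⟪a t, e + r • (x - e)⟫ = (1 - r) * ⟪a t, e⟫ + r * ⟪a t, x⟫ := fun t => by
      rw [inner_add_right, real_inner_smul_right, inner_sub_right]
      ring
    refine IsKKT.mem_Fop (lam := lam) ⟨hk.1, hk.2.1, fun t ht => ?_⟩ fun t => ?_
    · rw [hval, hke.2.2 t ht, hk.2.2 t ht]
      simp only [Pi.add_apply, Pi.smul_apply, Pi.sub_apply, smul_eq_mul]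
      ring
    · rw [hval]
      have h1 := mul_le_mul_of_nonneg_left (heS.1 t) (sub_nonneg.2 hr1)
      have h2 := mul_le_mul_of_nonneg_left (hx t) hr.le
      simp only [Pi.add_apply, Pi.smul_apply, Pi.sub_apply, smul_eq_mul]
      linarith
  · have hq : e + r • (p - e) ∈ Fop a c b := by
      convert convex_Fop a c b heS hp (sub_nonneg.2 hr1) hr.le (by ring) using 1
      module
    have hsub : e + r • (x - e) - (e + r • (p - e)) = r • (x - p) := by module
    rw [infEDist_eq_of_inner_nonpos hq, infEDist_eq_of_inner_nonpos hp hproj, edist_eq_enorm_sub,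
      hsub, enorm_smul, edist_eq_enorm_sub, Real.enorm_eq_ofReal hr.le]
    intro z hz
    have := hproj z hz
    rw [inner_sub_right] at this
    rw [hsub, real_inner_smul_left, inner_sub_right, inner_add_right, real_inner_smul_right,
      inner_sub_right, heu]
    refine mul_nonpos_of_nonneg_of_nonpos hr.le ?_
    linarith

theorem exists_mem_Eop_le_clmMod (h : (Fop a c b).Nonempty) {K : ℝ≥0∞}
    (hK : K < lipuscMod (fun p : EuclideanSpace ℝ (Fin n) × (Fin m → ℝ) => Fop a p.1 p.2) (c, b)) :
    ∃ e ∈ Eop a c b, K ≤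
      clmMod (fun p : EuclideanSpace ℝ (Fin n) × (Fin m → ℝ) => Fop a p.1 p.2) (c, b) e := by
  obtain ⟨⟨c', b'⟩, hlt, hp⟩ :=
    ((frequently_lt_of_lt_limsup (by isBoundedDefault) hK).and_eventually
      (eventually_exists_isKKT h)).exists
  obtain ⟨x, hx⟩ := lt_iSup_iff.1 hlt
  obtain ⟨hxM, hlt⟩ := lt_iSup_iff.1 hx
  obtain ⟨lam, hk, hkS⟩ := hp x hxM
  obtain ⟨e, he, hscale⟩ := exists_mem_Eop_contraction h hxM.1 hk hkS
  refine ⟨e, he, le_limsup_of_frequently_le ?_ (by isBoundedDefault)⟩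
  have htend : Tendsto (fun r : ℝ => e + r • (x - e)) (nhdsWithin 0 (Ioi 0)) (nhds e) := by
    have hcont : Continuous fun r : ℝ => e + r • (x - e) := by fun_prop
    simpa using (hcont.tendsto 0).mono_left nhdsWithin_le_nhds
  refine htend.frequently (Eventually.frequently ?_)
  filter_upwards [Ioc_mem_nhdsGT (zero_lt_one' ℝ)] with r hr
  obtain ⟨hmem, hdist⟩ := hscale r hr.1 hr.2
  have hr0 : ENNReal.ofReal r ≠ 0 := (ENNReal.ofReal_pos.2 hr.1).ne'
  have hle : Metric.infEDist (c, b) {p : EuclideanSpace ℝ (Fin n) × (Fin m → ℝ) |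
      e + r • (x - e) ∈ Fop a p.1 p.2} ≤ ENNReal.ofReal r * edist (c', b') (c, b) := by
    refine (Metric.infEDist_le_edist_of_mem
      (show (c, b + r • (b' - b)) ∈ {p : EuclideanSpace ℝ (Fin n) × (Fin m → ℝ) |
        e + r • (x - e) ∈ Fop a p.1 p.2} from hmem)).trans ?_
    rw [edist_comm, Prod.edist_eq, Prod.edist_eq]
    simp only [edist_self, zero_le, max_eq_right]
    rw [edist_eq_enorm_sub, add_sub_cancel_left, enorm_smul, Real.enorm_eq_ofReal hr.1.le,
      ← edist_eq_enorm_sub]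
    gcongr
    exact le_max_right _ _
  calc K ≤ Metric.infEDist x (Fop a c b) / edist (c', b') (c, b) := hlt.le
    _ = ENNReal.ofReal r * Metric.infEDist x (Fop a c b) /
        (ENNReal.ofReal r * edist (c', b') (c, b)) :=
      (ENNReal.mul_div_mul_left _ _ hr0 ENNReal.ofReal_ne_top).symm
    _ ≤ _ := by
      rw [← hdist]
      exact ENNReal.div_le_div_left hle _

end Moduli

/-- Let `(c̄,b̄) ∈ dom F^op`. Then
`Lipusc F^op(c̄,b̄) = Lipusc F_c̄^op(b̄) = sup_{x ∈ F^op(c̄,b̄)} clm F^op((c̄,b̄),x)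
= max_{x ∈ E^op(c̄,b̄)} clm F^op((c̄,b̄),x)`; in particular the supremum is attained at some
point of `E^op(c̄,b̄)`. -/
theorem lipusc_Fop_eq {n m : ℕ} (a : Fin m → EuclideanSpace ℝ (Fin n))
    (cbar : EuclideanSpace ℝ (Fin n)) (bbar : Fin m → ℝ)
    (h : (Fop a cbar bbar).Nonempty) :
    lipuscMod (fun p : EuclideanSpace ℝ (Fin n) × (Fin m → ℝ) => Fop a p.1 p.2) (cbar, bbar)
        = lipuscMod (fun b => Fop a cbar b) bbar ∧
    lipuscMod (fun p : EuclideanSpace ℝ (Fin n) × (Fin m → ℝ) => Fop a p.1 p.2) (cbar, bbar)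
        = (⨆ x ∈ Fop a cbar bbar,
            clmMod (fun p : EuclideanSpace ℝ (Fin n) × (Fin m → ℝ) => Fop a p.1 p.2)
              (cbar, bbar) x) ∧
    ∃ x ∈ Eop a cbar bbar,
      lipuscMod (fun p : EuclideanSpace ℝ (Fin n) × (Fin m → ℝ) => Fop a p.1 p.2) (cbar, bbar)
        = clmMod (fun p : EuclideanSpace ℝ (Fin n) × (Fin m → ℝ) => Fop a p.1 p.2)
            (cbar, bbar) x := by
  have hle : ∀ x ∈ Fop a cbar bbar,
      clmMod (fun p : EuclideanSpace ℝ (Fin n) × (Fin m → ℝ) => Fop a p.1 p.2) (cbar, bbar) x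
        ≤ lipuscMod (fun p : EuclideanSpace ℝ (Fin n) × (Fin m → ℝ) => Fop a p.1 p.2)
          (cbar, bbar) := fun x hx =>
    clmMod_le_lipuscMod (M := fun p : EuclideanSpace ℝ (Fin n) × (Fin m → ℝ) => Fop a p.1 p.2) hx
  obtain ⟨e, he, hmax⟩ := Set.exists_max_image (Eop a cbar bbar)
    (clmMod (fun p : EuclideanSpace ℝ (Fin n) × (Fin m → ℝ) => Fop a p.1 p.2) (cbar, bbar))
    (finite_Eop a cbar bbar) (Eop_nonempty h)
  have heq : lipuscMod (fun p : EuclideanSpace ℝ (Fin n) × (Fin m → ℝ) => Fop a p.1 p.2)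
      (cbar, bbar) = clmMod (fun p : EuclideanSpace ℝ (Fin n) × (Fin m → ℝ) => Fop a p.1 p.2)
        (cbar, bbar) e := by
    refine le_antisymm (le_of_forall_lt_imp_le_of_dense fun K hK => ?_) (hle e he.1.1)
    obtain ⟨e', he', hKe'⟩ := exists_mem_Eop_le_clmMod h hK
    exact hKe'.trans (hmax e' he')
  refine ⟨lipuscMod_Fop_fixed_cost h, le_antisymm ?_ (iSup₂_le hle), e, he, heq⟩
  rw [heq]
  exact le_iSup₂ (f := fun x (_ : x ∈ Fop a cbar bbar) =>
    clmMod (fun p : EuclideanSpace ℝ (Fin n) × (Fin m → ℝ) => Fop a p.1 p.2) (cbar, bbar) x)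
    e he.1.1
end

section
/- Let S = ⋃_{i∈I} S_i be a well-connected polyhedral mapping. Assume b, b̄ ∈ dom S_k for some k ∈ I. Take x ∈ S(b) and any x̄ ∈ P_{S(b̄)}(x). Then d(x, S(b̄))/d(b, b̄) ≤ clm S(b̄, x̄) (with the convention 0/0 := 0). -/
open scoped ENNReal
open Filter EMetric Set

/-- A convex polyhedral subset: a finite intersection of closed half-spaces. -/
def IsPolyhedral {E : Type*} [NormedAddCommGroup E] [NormedSpace ℝ E] (C : Set E) : Prop :=
  ∃ (k : ℕ) (f : Fin k → E →L[ℝ] ℝ) (c : Fin k → ℝ), C = {x | ∀ i, f i x ≤ c i}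

/-- `S = ⋃_{i ∈ I} S_i` is a well-connected polyhedral mapping: the graphs of the `S_i` are
nonempty convex polyhedral sets, `dom S` is convex, and the restriction of `S` to each
`dom S_i` equals `S_i`. -/
structure IsWellConnectedPolyhedral {Y X I : Type*}
    [NormedAddCommGroup Y] [NormedSpace ℝ Y] [NormedAddCommGroup X] [NormedSpace ℝ X]
    [Finite I] (S : Y → Set X) (Si : I → Y → Set X) : Prop where
  graph_nonempty : ∀ i, {p : Y × X | p.2 ∈ Si i p.1}.Nonempty
  graph_polyhedral : ∀ i, IsPolyhedral {p : Y × X | p.2 ∈ Si i p.1}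
  union : ∀ b, S b = ⋃ i, Si i b
  dom_convex : Convex ℝ {b | (S b).Nonempty}
  restrict : ∀ i b, (Si i b).Nonempty → S b = Si i b

/-- The set of best approximations (projections) of `x` onto `C`. -/
def projSet {E : Type*} [NormedAddCommGroup E] (C : Set E) (x : E) : Set E :=
  {y ∈ C | ∀ z ∈ C, ‖y - x‖ ≤ ‖z - x‖}

theorem IsPolyhedral.convex {E : Type*} [NormedAddCommGroup E] [NormedSpace ℝ E] {C : Set E}
    (hC : IsPolyhedral C) : Convex ℝ C := by
  obtain ⟨k, f, c, rfl⟩ := hC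
  rw [ofPred_forall]
  exact convex_iInter fun i => convex_halfSpace_le (f i).isLinear (c i)

/-- If `xbar` is a best approximation of `x` in `C`, a point at fraction `t` of the way from `xbar`
to `x` has distance at least `t * d(x, xbar)` to `C`. -/
theorem ofReal_mul_edist_le_infEDist {E : Type*} [NormedAddCommGroup E] [NormedSpace ℝ E]
    {C : Set E} {x xbar : E} (h : xbar ∈ projSet C x) {t : ℝ} (ht1 : t ≤ 1) :
    ENNReal.ofReal t * edist x xbar ≤ Metric.infEDist (AffineMap.lineMap xbar x t) C := by
  refine Metric.le_infEDist.2 fun z hz => ?_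
  obtain ht0 | ht0 := le_total t 0
  · simp [ENNReal.ofReal_of_nonpos ht0]
  rw [edist_dist, edist_dist, ← ENNReal.ofReal_mul ht0]
  refine ENNReal.ofReal_le_ofReal ?_
  have h1 : dist x xbar ≤ dist x z := by
    simpa only [dist_eq_norm, norm_sub_rev x] using h.2 z hz
  have h2 := dist_triangle x (AffineMap.lineMap xbar x t) z
  rw [dist_right_lineMap, Real.norm_of_nonneg (sub_nonneg.2 ht1), dist_comm xbar x] at h2
  linarith

/-- Let `S = ⋃_{i∈I} S_i` be a well-connected polyhedral mapping, let
`b, b̄ ∈ dom S_k` for some `k ∈ I`, `x ∈ S(b)` and `x̄ ∈ P_{S(b̄)}(x)`. Then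
`d(x, S(b̄))/d(b, b̄) ≤ clm S(b̄, x̄)`. -/
theorem ratio_le_clm_of_wellConnected {Y X I : Type*}
    [NormedAddCommGroup Y] [NormedSpace ℝ Y] [FiniteDimensional ℝ Y]
    [NormedAddCommGroup X] [NormedSpace ℝ X] [FiniteDimensional ℝ X]
    [Finite I] (S : Y → Set X) (Si : I → Y → Set X)
    (hS : IsWellConnectedPolyhedral S Si)
    (k : I) (b bbar : Y) (hb : (Si k b).Nonempty) (hbbar : (Si k bbar).Nonempty)
    (x : X) (hx : x ∈ S b) (xbar : X) (hxbar : xbar ∈ projSet (S bbar) x) :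
    EMetric.infEdist x (S bbar) / edist b bbar ≤ clmMod S bbar xbar := by
  rw [hS.restrict k b hb] at hx
  have hxbar' : xbar ∈ Si k bbar := hS.restrict k bbar hbbar ▸ hxbar.1
  have hx_lim : Tendsto (fun t : ℝ => AffineMap.lineMap xbar x t) (nhdsWithin 0 (Ioi 0))
      (nhds xbar) := by
    have hc : Continuous fun t : ℝ => AffineMap.lineMap xbar x t :=
      AffineMap.lineMap_continuous
    simpa using (hc.tendsto 0).mono_left nhdsWithin_le_nhds
  refine le_limsup_of_frequently_le (hx_lim.frequently (Eventually.frequently ?_))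
  filter_upwards [Ioc_mem_nhdsGT (zero_lt_one' ℝ)] with t ⟨ht0, ht1⟩
  have hmem : AffineMap.lineMap bbar b t ∈ {y | AffineMap.lineMap xbar x t ∈ S y} := by
    have hline := (hS.graph_polyhedral k).convex.lineMap_mem (x := (bbar, xbar)) (y := (b, x))
      hxbar' hx ⟨ht0.le, ht1⟩
    rw [mem_ofPred_eq, hS.union]
    refine mem_iUnion.2 ⟨k, ?_⟩
    simpa [AffineMap.lineMap_apply] using hline
  have hden : Metric.infEDist bbar {y | AffineMap.lineMap xbar x t ∈ S y} ≤
      ENNReal.ofReal t * edist b bbar := by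
    refine (Metric.infEDist_le_edist_of_mem hmem).trans_eq ?_
    rw [edist_dist, edist_dist, dist_left_lineMap, Real.norm_of_nonneg ht0.le,
      ENNReal.ofReal_mul ht0.le, dist_comm b]
  calc Metric.infEDist x (S bbar) / edist b bbar
      ≤ edist x xbar / edist b bbar := by
        gcongr
        exact Metric.infEDist_le_edist_of_mem hxbar.1
    _ = ENNReal.ofReal t * edist x xbar / (ENNReal.ofReal t * edist b bbar) :=
        (ENNReal.mul_div_mul_left _ _ (ENNReal.ofReal_pos.2 ht0).ne' ENNReal.ofReal_ne_top).symm
    _ ≤ _ := ENNReal.div_le_div (ofReal_mul_edist_le_infEDist hxbar ht1) hden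
end

section
/- For the optimal set mapping F^op under canonical perturbations one has: Hof F^op = 0 if a_t = 0_n for all t ∈ T, and Hof F^op = +∞ otherwise. -/
open scoped ENNReal RealInnerProductSpace
open Filter EMetric Set

theorem Fop_zero {n m : ℕ} (a : Fin m → EuclideanSpace ℝ (Fin n)) (b : Fin m → ℝ) :
    Fop a 0 b = Feas a b := by
  ext x
  simp [Fop]

/-- If every `a t` vanishes, every nonempty optimal set is the whole space. -/
theorem Fop_eq_univ_of_forall_eq_zero {n m : ℕ} {a : Fin m → EuclideanSpace ℝ (Fin n)}
    (ha : ∀ t, a t = 0) {c : EuclideanSpace ℝ (Fin n)} {b : Fin m → ℝ}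
    (h : (Fop a c b).Nonempty) : Fop a c b = univ := by
  obtain ⟨x, hx, hmin⟩ := h
  have hfeas (y : EuclideanSpace ℝ (Fin n)) : y ∈ Feas a b := by
    intro t
    simpa [ha t] using hx t
  have hc : c = 0 := by
    have h := hmin (x - c) (hfeas _)
    rw [inner_sub_right] at h
    exact real_inner_self_nonpos.mp (by simpa using h)
  rw [hc, Fop_zero]
  exact eq_univ_of_forall hfeas

/-- If `a s ≠ 0`, then for a suitable `b` the points `((-(ε • a s), b), -a s)` give ratios of at
least `ε⁻¹` in the Hoffman constant of the optimal set mapping. -/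
theorem inv_le_hofConst_Fop {n m : ℕ} (a : Fin m → EuclideanSpace ℝ (Fin n)) {s : Fin m}
    (hs : a s ≠ 0) {ε : ℝ} (hε : 0 < ε) :
    ENNReal.ofReal ε⁻¹ ≤
      hofConst (fun p : EuclideanSpace ℝ (Fin n) × (Fin m → ℝ) => Fop a p.1 p.2) := by
  have hnorm : 0 < ‖a s‖ := norm_pos_iff.mpr hs
  set b : Fin m → ℝ := fun t => max 0 (-⟪a t, a s⟫) with hb
  have hbs : b s = 0 := by
    simp [hb]
  have h_zero : (0 : EuclideanSpace ℝ (Fin n)) ∈ Feas a b := fun t => by simp [hb]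
  have h_neg : -a s ∈ Feas a b := fun t => by simp [hb, inner_neg_right]
  have h_opt : (0 : EuclideanSpace ℝ (Fin n)) ∈ Fop a (-(ε • a s)) b := by
    refine ⟨h_zero, fun y hy => ?_⟩
    have hys : ⟪a s, y⟫ ≤ 0 := hbs ▸ hy s
    rw [inner_zero_right, inner_neg_left, real_inner_smul_left]
    nlinarith
  have h_num : ENNReal.ofReal ‖a s‖ ≤ Metric.infEDist (-a s) (Fop a (-(ε • a s)) b) := by
    refine Metric.le_infEDist.mpr fun z hz => ?_
    have hzs : 0 ≤ ⟪a s, z⟫ := by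
      have h := hz.2 0 h_zero
      rw [inner_zero_right, inner_neg_left, real_inner_smul_left] at h
      nlinarith
    rw [edist_dist, dist_comm, dist_eq_norm]
    refine ENNReal.ofReal_le_ofReal ?_
    have hcs := real_inner_le_norm (a s) (z - -a s)
    rw [sub_neg_eq_add, inner_add_right, real_inner_self_eq_norm_sq] at hcs
    rw [sub_neg_eq_add]
    nlinarith
  have h_den : Metric.infEDist (-(ε • a s), b)
      {p : EuclideanSpace ℝ (Fin n) × (Fin m → ℝ) | -a s ∈ Fop a p.1 p.2} ≤
      ENNReal.ofReal (ε * ‖a s‖) := by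
    have hmem : ((0, b) : EuclideanSpace ℝ (Fin n) × (Fin m → ℝ)) ∈
        {p : EuclideanSpace ℝ (Fin n) × (Fin m → ℝ) | -a s ∈ Fop a p.1 p.2} := by
      simpa [Fop_zero] using h_neg
    refine (Metric.infEDist_le_edist_of_mem hmem).trans ?_
    simp [edist_dist, norm_smul, abs_of_pos hε]
  calc ENNReal.ofReal ε⁻¹ = ENNReal.ofReal ‖a s‖ / ENNReal.ofReal (ε * ‖a s‖) := by
        rw [← ENNReal.ofReal_div_of_pos (by positivity)]
        congr 1
        field_simp
    _ ≤ _ := ENNReal.div_le_div h_num h_den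
    _ ≤ _ := by
        refine le_iSup₂_of_le (-(ε • a s), b) ⟨0, h_opt⟩ ?_
        exact le_iSup (fun x => Metric.infEDist x (Fop a (-(ε • a s)) b) /
          Metric.infEDist (-(ε • a s), b)
            {p : EuclideanSpace ℝ (Fin n) × (Fin m → ℝ) | x ∈ Fop a p.1 p.2}) (-a s)

/-- For the optimal set mapping `F^op` under canonical perturbations:
`Hof F^op = 0` if `a_t = 0` for all `t ∈ T`, and `Hof F^op = +∞` otherwise. -/
theorem hof_Fop_canonical {n m : ℕ} (a : Fin m → EuclideanSpace ℝ (Fin n)) :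
    ((∀ t, a t = 0) →
      hofConst (fun p : EuclideanSpace ℝ (Fin n) × (Fin m → ℝ) => Fop a p.1 p.2) = 0) ∧
    ((¬ ∀ t, a t = 0) →
      hofConst (fun p : EuclideanSpace ℝ (Fin n) × (Fin m → ℝ) => Fop a p.1 p.2) = ⊤) := by
  refine ⟨fun ha => ?_, fun ha => ?_⟩
  · simp only [hofConst, ENNReal.iSup_eq_zero]
    intro y hy x
    rw [Fop_eq_univ_of_forall_eq_zero ha hy]
    exact ENNReal.div_eq_zero_iff.mpr (Or.inl (Metric.infEDist_zero_of_mem (mem_univ x)))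
  · obtain ⟨s, hs⟩ := not_forall.mp ha
    refine ENNReal.eq_top_of_forall_nnreal_le fun r => ?_
    refine le_trans ?_ (inv_le_hofConst_Fop a hs (ε := (r + 1 : ℝ)⁻¹) (by positivity))
    rw [inv_inv, ← ENNReal.ofReal_coe_nnreal]
    exact ENNReal.ofReal_le_ofReal (by linarith)
end

section
/- Let −c̄ ∈ cone{a_t : t ∈ T}. Then M_c̄ = ⋃_{b ∈ dom F} M_{c̄,b}. -/
open scoped ENNReal RealInnerProductSpace
open Filter EMetric Set

/-- `M_c = {D ⊆ T : −c ∈ cone{a_t : t ∈ D} and D minimal w.r.t. inclusion}`. -/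
def Mc {n m : ℕ} (a : Fin m → EuclideanSpace ℝ (Fin n)) (c : EuclideanSpace ℝ (Fin n)) :
    Set (Finset (Fin m)) :=
  {D | InCone a D (-c) ∧ ∀ D' ⊆ D, InCone a D' (-c) → D' = D}

/-- If `-c` lies in the cone generated by the `a_t`, the origin is optimal for the homogeneous
system `b = 0`. -/
theorem zero_mem_Fop_zero {n m : ℕ} {a : Fin m → EuclideanSpace ℝ (Fin n)}
    {c : EuclideanSpace ℝ (Fin n)} {D : Finset (Fin m)} (hc : InCone a D (-c)) :
    0 ∈ Fop a c 0 := by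
  refine ⟨fun t => by simp, fun y hy => ?_⟩
  obtain ⟨lam, hlam, -, hsum⟩ := hc
  have hle : ⟪-c, y⟫ ≤ 0 := by
    rw [hsum, sum_inner]
    refine Finset.sum_nonpos fun t _ => ?_
    rw [real_inner_smul_left]
    exact mul_nonpos_of_nonneg_of_nonpos (hlam t) (hy t)
  rw [inner_neg_left] at hle
  rw [inner_zero_right]
  linarith

/-- Let `−c̄ ∈ cone{a_t : t ∈ T}`. Then `M_c̄ = ⋃_{b ∈ dom F} M_{c̄,b}`. -/
theorem Mc_eq_iUnion_Mcb {n m : ℕ} (a : Fin m → EuclideanSpace ℝ (Fin n))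
    (cbar : EuclideanSpace ℝ (Fin n)) (hc : InCone a Finset.univ (-cbar)) :
    Mc a cbar = ⋃ b ∈ {b : Fin m → ℝ | (Feas a b).Nonempty}, Mcb a cbar b := by
  ext D
  simp only [mem_iUnion]
  constructor
  · intro hD
    have h0 := zero_mem_Fop_zero hc
    exact ⟨0, ⟨0, h0.1⟩, 0, h0, fun t _ => by simp [activeSet], hD⟩
  · rintro ⟨b, -, x, -, -, hD⟩
    exact hD
end
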